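/- Let (G, p, L) be a minimum counterexample, minimizing the number of vertices and edges of G, to the following statement: 'Every plane graph G with no 5-cycle and no 6-cycle, with p ∈ V(G) and L a (*,1)-list assignment with |L(p)| = 1 and |L(v)| = 3 for all v ≠ p, is L-colorable.' Then G contains no diamond xz1yz2 (a 4-cycle xz1yz2 formed by two adjacent 3-faces xyz1 and xyz2 sharing the edge xy) with deg(x) = 3 and deg(y) = 4. -/

import Mathlib

open Set

namespace ChoosSep

/-- `G` has a cycle of length `n`. -/
def HasCycleLen {V : Type} (G : SimpleGraph V) (n : ℕ) : Prop :=
  ∃ (v : V) (c : G.Walk v v), c.IsCycle ∧ c.length = n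

/-- `G` has a proper coloring choosing each color from the list `L v`. -/
def ColorableWith {V : Type} (G : SimpleGraph V) (L : V → Finset ℕ) : Prop :=
  ∃ φ : V → ℕ, (∀ v, φ v ∈ L v) ∧ ∀ ⦃u v⦄, G.Adj u v → φ u ≠ φ v

/-- `G` is `(k,d)`-choosable: it has an `L`-coloring for every list assignment
giving each vertex at least `k` colors and any two adjacent vertices at most `d`
common colors. -/
def Choosable {V : Type} (G : SimpleGraph V) (k d : ℕ) : Prop :=
  ∀ L : V → Finset ℕ, (∀ v, k ≤ (L v).card) →
    (∀ ⦃u v⦄, G.Adj u v → ((L u) ∩ (L v)).card ≤ d) →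
    ColorableWith G L

/-- The closed straight segment between two points of the plane. -/
def seg (x y : ℝ × ℝ) : Set (ℝ × ℝ) := segment ℝ x y

/-- A straight-line plane embedding of `G`: vertices go to distinct points, edges are
drawn as straight segments, two distinct edges meet only in common endpoints, and no
vertex lies on the drawing of an edge it does not belong to.  By Fáry's theorem a
finite simple graph admits such an embedding iff it is planar. -/
structure PlaneEmb {V : Type} (G : SimpleGraph V) where
  pos : V → ℝ × ℝ
  inj : Function.Injective pos
  edges_meet : ∀ ⦃a b c d : V⦄, G.Adj a b → G.Adj c d → s(a, b) ≠ s(c, d) →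
    seg (pos a) (pos b) ∩ seg (pos c) (pos d) ⊆ ({pos a, pos b} ∩ {pos c, pos d} : Set (ℝ × ℝ))
  vertex_off : ∀ ⦃a b v : V⦄, G.Adj a b → v ≠ a → v ≠ b → pos v ∉ seg (pos a) (pos b)

/-- `G` is planar: it admits a plane embedding. -/
def IsPlanar {V : Type} (G : SimpleGraph V) : Prop := Nonempty (PlaneEmb G)

variable {V : Type} {G : SimpleGraph V}

/-- The drawing of the graph in the plane: all vertex points and all edge segments. -/
def PlaneEmb.drawing (E : PlaneEmb G) : Set (ℝ × ℝ) :=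
  Set.range E.pos ∪ ⋃ (a : V) (b : V) (_ : G.Adj a b), seg (E.pos a) (E.pos b)

/-- A face of the embedding: a connected component of the complement of the drawing. -/
def PlaneEmb.IsFace (E : PlaneEmb G) (C : Set (ℝ × ℝ)) : Prop :=
  ∃ q, q ∉ E.drawing ∧ C = connectedComponentIn E.drawingᶜ q

/-- The outer face: the unbounded face. -/
def PlaneEmb.IsOuterFace (E : PlaneEmb G) (C : Set (ℝ × ℝ)) : Prop :=
  E.IsFace C ∧ ¬ Bornology.IsBounded C

/-- The vertices lying on the boundary of the face `C`. -/
def PlaneEmb.onFace (E : PlaneEmb G) (C : Set (ℝ × ℝ)) : Set V :=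
  {v | E.pos v ∈ closure C}

/-- An edge of `G` lying on the boundary of the face `C`. -/
def PlaneEmb.BoundaryEdge (E : PlaneEmb G) (C : Set (ℝ × ℝ)) (u v : V) : Prop :=
  G.Adj u v ∧ seg (E.pos u) (E.pos v) ⊆ closure C

/-- `C` is a 3-face with (mutually adjacent) incident vertices `x`, `y`, `z`. -/
def PlaneEmb.IsTriFace (E : PlaneEmb G) (C : Set (ℝ × ℝ)) (x y z : V) : Prop :=
  E.IsFace C ∧ G.Adj x y ∧ G.Adj y z ∧ G.Adj x z ∧
    frontier C = seg (E.pos x) (E.pos y) ∪ seg (E.pos y) (E.pos z) ∪ seg (E.pos x) (E.pos z)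

/-- `C` is a 4-face with incident 4-cycle `w x y z`. -/
def PlaneEmb.IsQuadFace (E : PlaneEmb G) (C : Set (ℝ × ℝ)) (w x y z : V) : Prop :=
  E.IsFace C ∧ G.Adj w x ∧ G.Adj x y ∧ G.Adj y z ∧ G.Adj z w ∧ w ≠ y ∧ x ≠ z ∧
    frontier C = seg (E.pos w) (E.pos x) ∪ seg (E.pos x) (E.pos y) ∪
      seg (E.pos y) (E.pos z) ∪ seg (E.pos z) (E.pos w)

/-- `x z1 y z2` is a diamond: a 4-cycle formed by two adjacent 3-faces
`x y z1` and `x y z2` sharing the edge `x y`. -/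
def PlaneEmb.IsDiamond (E : PlaneEmb G) (x z1 y z2 : V) : Prop :=
  z1 ≠ z2 ∧ ∃ C1 C2 : Set (ℝ × ℝ), C1 ≠ C2 ∧ E.IsTriFace C1 x y z1 ∧ E.IsTriFace C2 x y z2

/-- The union of the three sides of the triangle `a b c`. -/
def triBoundary (a b c : ℝ × ℝ) : Set (ℝ × ℝ) := seg a b ∪ seg b c ∪ seg a c

/-- The open interior region of the triangle `a b c`: points off the triangle whose
connected component in the complement of the triangle is bounded. -/
def triInterior (a b c : ℝ × ℝ) : Set (ℝ × ℝ) :=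
  {p | p ∉ triBoundary a b c ∧
    Bornology.IsBounded (connectedComponentIn (triBoundary a b c)ᶜ p)}

/-- The degree of a vertex. -/
noncomputable def deg (G : SimpleGraph V) (v : V) : ℕ := Nat.card {u : V // G.Adj v u}

/-- `G` is 2-connected: connected and with no cutvertex. -/
def TwoConnected (G : SimpleGraph V) : Prop :=
  G.Connected ∧ ∀ v : V, (G.induce {u : V | u ≠ v}).Connected

/-- A configuration for Theorem 8: a plane graph with no 5-cycle and no 6-cycle, a
vertex `p`, and a `(*,1)`-list assignment with `|L(p)| = 1` and `|L(v)| = 3`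
for every other vertex. -/
structure Cfg56 where
  n : ℕ
  G : SimpleGraph (Fin n)
  E : PlaneEmb G
  p : Fin n
  L : Fin n → Finset ℕ

namespace Cfg56

/-- All hypotheses of Theorem 8 hold for the configuration. -/
def Valid (C : Cfg56) : Prop :=
  (¬ HasCycleLen C.G 5) ∧ (¬ HasCycleLen C.G 6) ∧
  (∀ ⦃u v⦄, C.G.Adj u v → ((C.L u) ∩ (C.L v)).card ≤ 1) ∧
  (C.L C.p).card = 1 ∧
  (∀ v, v ≠ C.p → (C.L v).card = 3)

/-- The configuration admits an `L`-coloring. -/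
def Colorable (C : Cfg56) : Prop := ColorableWith C.G C.L

/-- The quantity `|V(G)| + |E(G)|`. -/
noncomputable def measure (C : Cfg56) : ℕ := C.n + Nat.card ↥C.G.edgeSet

/-- `C` is a minimum counterexample to Theorem 8: it satisfies the hypotheses, has no
`L`-coloring, and minimizes `|V(G)| + |E(G)|` among all such counterexamples. -/
def MinCounterexample (C : Cfg56) : Prop :=
  C.Valid ∧ ¬ C.Colorable ∧
    ∀ D : Cfg56, D.Valid → ¬ D.Colorable → C.measure ≤ D.measure

end Cfg56

/-- A plane embedding restricts to any spanning subgraph. -/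
def PlaneEmb.ofLE {H : SimpleGraph V} (E : PlaneEmb G) (h : H ≤ G) : PlaneEmb H where
  pos := E.pos
  inj := E.inj
  edges_meet _ _ _ _ hab hcd hne := E.edges_meet (h hab) (h hcd) hne
  vertex_off _ _ _ hab hva hvb := E.vertex_off (h hab) hva hvb

theorem HasCycleLen.mono {H : SimpleGraph V} (h : H ≤ G) {n : ℕ} (hc : HasCycleLen H n) :
    HasCycleLen G n := by
  obtain ⟨v, c, hc, hn⟩ := hc
  exact ⟨v, c.mapLe h, hc.mapLe h, by simpa using hn⟩

namespace Cfg56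

/-- Every proper spanning subgraph of a minimum counterexample is colorable from its lists. -/
theorem MinCounterexample.colorableWith_of_lt {C : Cfg56} (hC : C.MinCounterexample)
    {H : SimpleGraph (Fin C.n)} (h : H < C.G) : ColorableWith H C.L := by
  by_contra hcol
  obtain ⟨⟨h5, h6, hsep, hp, hL⟩, -, hmin⟩ := hC
  have hle := hmin ⟨C.n, H, C.E.ofLE h.le, C.p, C.L⟩
    ⟨fun hc => h5 (hc.mono h.le), fun hc => h6 (hc.mono h.le),
      fun u v huv => hsep (h.le huv), hp, hL⟩ hcol
  have hlt : H.edgeSet.ncard < C.G.edgeSet.ncard :=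
    Set.ncard_lt_ncard (SimpleGraph.edgeSet_strict_mono h) (Set.toFinite _)
  rw [← Nat.card_coe_set_eq, ← Nat.card_coe_set_eq] at hlt
  simp only [measure] at hle
  omega

/-- Deleting an edge `uv` of a minimum counterexample leaves a graph with a list coloring,
and any such coloring gives `u` and `v` the same color. -/
theorem MinCounterexample.exists_coloring_deleteEdge {C : Cfg56} (hC : C.MinCounterexample)
    {u v : Fin C.n} (huv : C.G.Adj u v) :
    ∃ φ : Fin C.n → ℕ, (∀ w, φ w ∈ C.L w) ∧ φ u = φ v ∧
      ∀ ⦃a b⦄, C.G.Adj a b → s(a, b) ≠ s(u, v) → φ a ≠ φ b := by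
  have hlt : C.G.deleteEdges {s(u, v)} < C.G := by
    refine lt_of_le_of_ne (SimpleGraph.deleteEdges_le _) fun h => ?_
    rw [← h] at huv
    simp at huv
  obtain ⟨φ, hφ, hadj⟩ := hC.colorableWith_of_lt hlt
  have hadj' : ∀ ⦃a b⦄, C.G.Adj a b → s(a, b) ≠ s(u, v) → φ a ≠ φ b := fun a b hab hne =>
    hadj (SimpleGraph.deleteEdges_adj.2 ⟨hab, hne⟩)
  refine ⟨φ, hφ, ?_, hadj'⟩
  by_contra hne
  refine hC.2.1 ⟨φ, hφ, fun a b hab => ?_⟩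
  by_cases he : s(a, b) = s(u, v)
  · rcases Sym2.eq_iff.1 he with ⟨rfl, rfl⟩ | ⟨rfl, rfl⟩
    · exact hne
    · exact Ne.symm hne
  · exact hadj' hab he

/-- The color of `p` belongs to the list of each of its neighbors. -/
theorem MinCounterexample.mem_list_of_adj {C : Cfg56} (hC : C.MinCounterexample)
    {c : ℕ} (hc : C.L C.p = {c}) {u : Fin C.n} (hu : C.G.Adj C.p u) : c ∈ C.L u := by
  obtain ⟨φ, hφ, heq, -⟩ := hC.exists_coloring_deleteEdge hu
  have h : φ C.p = c := by simpa [hc] using hφ C.p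
  rw [← h, heq]
  exact hφ u

/-- The vertex `p` of a minimum counterexample lies on no triangle. -/
theorem MinCounterexample.not_triangle {C : Cfg56} (hC : C.MinCounterexample)
    {u v : Fin C.n} (hu : C.G.Adj C.p u) (hv : C.G.Adj C.p v) (huv : C.G.Adj u v) : False := by
  obtain ⟨c, hc⟩ := Finset.card_eq_one.1 hC.1.2.2.2.1
  obtain ⟨φ, hφ, heq, hadj⟩ := hC.exists_coloring_deleteEdge huv
  have hp : φ C.p = c := by simpa [hc] using hφ C.p
  have hne : φ C.p ≠ φ u := hadj hu fun h => by
    rcases Sym2.eq_iff.1 h with ⟨h, -⟩ | ⟨h, -⟩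
    · exact hu.ne h
    · exact hv.ne h
  refine hne (Finset.card_le_one.1 (hC.1.2.2.1 huv) _ ?_ _ ?_)
  · rw [hp]
    exact Finset.mem_inter.2 ⟨hC.mem_list_of_adj hc hu, hC.mem_list_of_adj hc hv⟩
  · exact Finset.mem_inter.2 ⟨hφ u, heq ▸ hφ v⟩

end Cfg56

theorem adj_iff_of_deg_eq_three [Finite V] {x a b c : V} (hdeg : deg G x = 3)
    (ha : G.Adj x a) (hb : G.Adj x b) (hc : G.Adj x c)
    (hab : a ≠ b) (hac : a ≠ c) (hbc : b ≠ c) {v : V} :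
    G.Adj x v ↔ v = a ∨ v = b ∨ v = c := by
  have hcard : ({a, b, c} : Set V).ncard = 3 := Set.ncard_eq_three.2 ⟨a, b, c, hab, hac, hbc, rfl⟩
  have hN : {u | G.Adj x u}.ncard = 3 := hdeg
  have hsub : ({a, b, c} : Set V) ⊆ {u | G.Adj x u} := by
    rintro u (rfl | rfl | rfl) <;> assumption
  have heq := Set.eq_of_subset_of_ncard_le hsub (by rw [hN, hcard]) (Set.toFinite _)
  exact (Set.ext_iff.1 heq v).symm

theorem exists_adj_iff_of_deg_eq_four [Finite V] {x a b c : V} (hdeg : deg G x = 4)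
    (ha : G.Adj x a) (hb : G.Adj x b) (hc : G.Adj x c)
    (hab : a ≠ b) (hac : a ≠ c) (hbc : b ≠ c) :
    ∃ d, ∀ v, G.Adj x v ↔ v = a ∨ v = b ∨ v = c ∨ v = d := by
  have hcard : ({a, b, c} : Set V).ncard = 3 := Set.ncard_eq_three.2 ⟨a, b, c, hab, hac, hbc, rfl⟩
  have hN : {u | G.Adj x u}.ncard = 4 := hdeg
  have hsub : ({a, b, c} : Set V) ⊆ {u | G.Adj x u} := by
    rintro u (rfl | rfl | rfl) <;> assumption
  have hdiff := Set.ncard_sdiff_add_ncard_of_subset hsub (Set.toFinite _)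
  obtain ⟨d, hd⟩ := Set.ncard_eq_one.1 (show ({u | G.Adj x u} \ {a, b, c}).ncard = 1 by omega)
  have hxd : G.Adj x d := (hd ▸ Set.mem_singleton d : d ∈ {u | G.Adj x u} \ {a, b, c}).1
  refine ⟨d, fun v => ⟨fun hv => ?_, ?_⟩⟩
  · by_cases hmem : v ∈ ({a, b, c} : Set V)
    · rcases hmem with h | h | h <;> tauto
    · have : v ∈ ({d} : Set V) := hd ▸ ⟨hv, hmem⟩
      tauto
  · rintro (rfl | rfl | rfl | rfl) <;> assumption

/-- **Configuration (C5) is reducible.** A minimum counterexample to Theorem 8 contains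
no diamond `x z1 y z2` (two adjacent 3-faces `x y z1` and `x y z2` sharing the edge
`x y`) with `deg(x) = 3` and `deg(y) = 4`. -/
theorem min_cex_C5C6free_no_crown (C : Cfg56) (hC : C.MinCounterexample) :
    ¬ ∃ x z1 y z2 : Fin C.n, C.E.IsDiamond x z1 y z2 ∧
      deg C.G x = 3 ∧ deg C.G y = 4 := by
  rintro ⟨x, z1, y, z2, ⟨hz, T1, T2, -, ⟨-, hxy, hyz1, hxz1, -⟩, ⟨-, -, hyz2, hxz2, -⟩⟩, hx, hy⟩
  obtain ⟨-, -, hsep, -, hL⟩ := hC.1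
  have hxp : x ≠ C.p := by
    rintro rfl
    exact hC.not_triangle hxy hxz1 hyz1
  have hyp : y ≠ C.p := by
    rintro rfl
    exact hC.not_triangle hxy.symm hyz1 hxz1
  have hNx : ∀ v, C.G.Adj x v ↔ v = y ∨ v = z1 ∨ v = z2 := fun v =>
    adj_iff_of_deg_eq_three hx hxy hxz1 hxz2 hyz1.ne hyz2.ne hz
  obtain ⟨w, hNy⟩ :=
    exists_adj_iff_of_deg_eq_four hy hxy.symm hyz1 hyz2 hxz1.ne hxz2.ne hz
  have hlt : C.G.deleteIncidenceSet x < C.G := by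
    refine lt_of_le_of_ne (SimpleGraph.deleteIncidenceSet_le _ _) fun h => ?_
    rw [← h] at hxy
    simp [SimpleGraph.deleteIncidenceSet_adj] at hxy
  obtain ⟨φ, hφ, hadj⟩ := hC.colorableWith_of_lt hlt
  have hφadj : ∀ ⦃u v⦄, C.G.Adj u v → u ≠ x → v ≠ x → φ u ≠ φ v := fun u v huv hu hv =>
    hadj (SimpleGraph.deleteIncidenceSet_adj.2 ⟨huv, hu, hv⟩)
  have h_extend : ∀ ψ : Fin C.n → ℕ, (∀ v, ψ v ∈ C.L v) → (∀ v, C.G.Adj x v → ψ x ≠ ψ v) →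
      (∀ u v, C.G.Adj u v → u ≠ x → v ≠ x → ψ u ≠ ψ v) → False := by
    intro ψ hψ hψx hψadj
    refine hC.2.1 ⟨ψ, hψ, fun u v huv => ?_⟩
    by_cases hu : u = x
    · subst hu
      exact hψx v huv
    by_cases hv : v = x
    · subst hv
      exact (hψx u huv.symm).symm
    · exact hψadj u v huv hu hv
  by_cases hfree : ∃ c ∈ C.L x, c ∉ ({φ y, φ z1, φ z2} : Finset ℕ)
  · obtain ⟨c, hc, hcn⟩ := hfree
    simp only [Finset.mem_insert, Finset.mem_singleton, not_or] at hcn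
    refine h_extend (Function.update φ x c) (fun v => ?_) (fun v hv => ?_) fun u v huv hu hv => ?_
    · by_cases h : v = x
      · subst h
        simpa using hc
      · simpa [h] using hφ v
    · rw [Function.update_self, Function.update_of_ne hv.ne']
      rcases (hNx v).1 hv with rfl | rfl | rfl <;> tauto
    · rw [Function.update_of_ne hu, Function.update_of_ne hv]
      exact hφadj huv hu hv
  push Not at hfree
  have hLx : C.L x = {φ y, φ z1, φ z2} :=
    Finset.eq_of_subset_of_card_le hfree (by rw [hL x hxp]; exact Finset.card_le_three)
  have hblock : ∀ z, C.G.Adj y z → z ≠ x → φ z ∈ C.L x → φ z ∉ C.L y := by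
    intro z hyz hzx hzLx hzLy
    exact hφadj hyz hxy.ne' hzx (Finset.card_le_one.1 (hsep hxy) _
      (Finset.mem_inter.2 ⟨by simp [hLx], hφ y⟩) _ (Finset.mem_inter.2 ⟨hzLx, hzLy⟩))
  have hz1 := hblock z1 hyz1 hxz1.ne' (by simp [hLx])
  have hz2 := hblock z2 hyz2 hxz2.ne' (by simp [hLx])
  obtain ⟨d, hd, hdn⟩ : ∃ d ∈ C.L y, d ∉ ({φ y, φ w} : Finset ℕ) := by
    apply Finset.exists_mem_notMem_of_card_lt_card
    rw [hL y hyp]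
    exact lt_of_le_of_lt Finset.card_le_two (by norm_num)
  simp only [Finset.mem_insert, Finset.mem_singleton, not_or] at hdn
  have hyd : ∀ v, C.G.Adj y v → v ≠ x → d ≠ φ v := by
    intro v hv hvx hdv
    rcases (hNy v).1 hv with rfl | rfl | rfl | rfl
    · exact hvx rfl
    · exact hz1 (hdv ▸ hd)
    · exact hz2 (hdv ▸ hd)
    · exact hdn.2 hdv
  refine h_extend (Function.update (Function.update φ y d) x (φ y)) (fun v => ?_) (fun v hv => ?_)
    fun u v huv hu hv => ?_
  · by_cases h : v = x
    · subst h
      simp [hLx]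
    by_cases h' : v = y
    · subst h'
      simpa [h] using hd
    · simpa [h, h'] using hφ v
  · rw [Function.update_self, Function.update_of_ne hv.ne']
    rcases (hNx v).1 hv with rfl | rfl | rfl
    · simpa using Ne.symm hdn.1
    · rw [Function.update_of_ne hyz1.ne']
      exact hφadj hyz1 hxy.ne' hv.ne'
    · rw [Function.update_of_ne hyz2.ne']
      exact hφadj hyz2 hxy.ne' hv.ne'
  · rw [Function.update_of_ne hu, Function.update_of_ne hv]
    by_cases huy : u = y
    · subst huy
      rw [Function.update_self, Function.update_of_ne huv.ne']
      exact hyd v huv hv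
    by_cases hvy : v = y
    · subst hvy
      rw [Function.update_self, Function.update_of_ne huy]
      exact (hyd u huv.symm hu).symm
    · rw [Function.update_of_ne huy, Function.update_of_ne hvy]
      exact hφadj huv hu hv

end ChoosSep
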